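/- Let A and B be the p×p matrices over F_p(λ, μ) from the multilinear Weyl representation (A upper bidiagonal with diagonal λ and superdiagonal entries 1,...,p−1; B with μ in the top-right corner and subdiagonal entries 1). Then each of the matrices A − I, B − I, A − B, AB − I, BA − I, AB − A, AB − B, BA − A, BA − B, AB − BA is invertible. -/

import Mathlib

/-- The field `F_p(λ, μ)` of rational functions in two variables over `F_p`. -/
abbrev RatFunc2 (p : ℕ) : Type := FractionRing (MvPolynomial (Fin 2) (ZMod p))

noncomputable def lamVar (p : ℕ) : RatFunc2 p :=
  algebraMap (MvPolynomial (Fin 2) (ZMod p)) (RatFunc2 p) (MvPolynomial.X 0)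

noncomputable def muVar (p : ℕ) : RatFunc2 p :=
  algebraMap (MvPolynomial (Fin 2) (ZMod p)) (RatFunc2 p) (MvPolynomial.X 1)

/-- The `p×p` matrix with `λ` on the diagonal and `1, 2, …, p-1` on the superdiagonal. -/
noncomputable def matA (p : ℕ) : Matrix (Fin p) (Fin p) (RatFunc2 p) :=
  Matrix.of fun i j =>
    if i = j then lamVar p
    else if (j : ℕ) = (i : ℕ) + 1 then (((i : ℕ) + 1 : ℕ) : RatFunc2 p)
    else 0

/-- The `p×p` matrix with `μ` in the top-right corner and `1`'s on the subdiagonal. -/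
noncomputable def matB (p : ℕ) : Matrix (Fin p) (Fin p) (RatFunc2 p) :=
  Matrix.of fun i j =>
    if (i : ℕ) = 0 ∧ (j : ℕ) = p - 1 then muVar p
    else if (i : ℕ) = (j : ℕ) + 1 then 1
    else 0

open Matrix in
lemma matA_mulVec (p : ℕ) (v : Fin p → RatFunc2 p) (i : Fin p) :
    (matA p *ᵥ v) i = lamVar p * v i +
      if h : (i : ℕ) + 1 < p then (((i : ℕ) + 1 : ℕ) : RatFunc2 p) * v ⟨i + 1, h⟩ else 0 := by
  have h1 : ∀ j : Fin p, matA p i j * v j = (if i = j then lamVar p * v j else 0) +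
      (if (j : ℕ) = (i : ℕ) + 1 then (((i : ℕ) + 1 : ℕ) : RatFunc2 p) * v j else 0) := by
    intro j
    simp only [matA, Matrix.of_apply]
    by_cases hij : i = j
    · subst hij; simp
    · simp only [hij, if_false]
      split_ifs <;> simp
  simp only [Matrix.mulVec, dotProduct]
  rw [Finset.sum_congr rfl (fun j _ => h1 j), Finset.sum_add_distrib, Finset.sum_ite_eq]
  simp only [Finset.mem_univ, if_true]
  congr 1
  split_ifs with h
  · rw [Finset.sum_eq_single (⟨i + 1, h⟩ : Fin p)]
    · simp
    · intro b _ hb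
      rw [if_neg]
      intro hb'
      exact hb (Fin.ext hb')
    · simp
  · apply Finset.sum_eq_zero
    intro j _
    rw [if_neg]
    have := j.2
    omega

open Matrix in
lemma matB_mulVec_zero (p : ℕ) (v : Fin p → RatFunc2 p) (i : Fin p) (hi : (i : ℕ) = 0) :
    (matB p *ᵥ v) i = muVar p * v ⟨p - 1, by have := i.2; omega⟩ := by
  simp only [Matrix.mulVec, dotProduct]
  rw [Finset.sum_eq_single (⟨p - 1, by have := i.2; omega⟩ : Fin p)]
  · simp only [matB, hi, Matrix.of_apply, and_self, if_true]
  · intro b _ hb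
    have hb' : (b : ℕ) ≠ p - 1 := fun h => hb (Fin.ext h)
    rw [matB, Matrix.of_apply, if_neg (by omega), if_neg (by omega), zero_mul]
  · exact fun h => absurd (Finset.mem_univ _) h

open Matrix in
lemma matB_mulVec_pos (p : ℕ) (v : Fin p → RatFunc2 p) (k : ℕ) (hk : k + 1 < p) :
    (matB p *ᵥ v) ⟨k + 1, hk⟩ = v ⟨k, by omega⟩ := by
  simp only [Matrix.mulVec, dotProduct]
  rw [Finset.sum_eq_single (⟨k, by omega⟩ : Fin p)]
  · simp [matB]
  · intro b _ hb
    have hb' : k ≠ (b : ℕ) := fun h => hb (Fin.ext h.symm)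
    rw [matB, Matrix.of_apply, if_neg (by simp only; omega), if_neg (by simp only; omega), zero_mul]
  · exact fun h => absurd (Finset.mem_univ _) h

lemma lamVar_ne (p : ℕ) [Fact p.Prime] : lamVar p ≠ 0 := by
  unfold lamVar
  rw [Ne, FaithfulSMul.algebraMap_eq_zero_iff]
  exact MvPolynomial.X_ne_zero _

lemma muVar_ne (p : ℕ) [Fact p.Prime] : muVar p ≠ 0 := by
  unfold muVar
  rw [Ne, FaithfulSMul.algebraMap_eq_zero_iff]
  exact MvPolynomial.X_ne_zero _

lemma X_ne_one' (p : ℕ) [Fact p.Prime] (i : Fin 2) :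
    (MvPolynomial.X i : MvPolynomial (Fin 2) (ZMod p)) ≠ 1 := by
  intro h
  have := congrArg (MvPolynomial.eval (fun _ => (0 : ZMod p))) h
  simp at this

lemma lamVar_ne_one (p : ℕ) [Fact p.Prime] : lamVar p ≠ 1 := by
  unfold lamVar
  rw [← map_one (algebraMap (MvPolynomial (Fin 2) (ZMod p)) (RatFunc2 p))]
  exact fun h => X_ne_one' p 0 (FaithfulSMul.algebraMap_injective _ _ h)

lemma muVar_ne_one (p : ℕ) [Fact p.Prime] : muVar p ≠ 1 := by
  unfold muVar
  rw [← map_one (algebraMap (MvPolynomial (Fin 2) (ZMod p)) (RatFunc2 p))]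
  exact fun h => X_ne_one' p 1 (FaithfulSMul.algebraMap_injective _ _ h)

open Matrix in
lemma isUnit_of_ker (p : ℕ) [Fact p.Prime] (M : Matrix (Fin p) (Fin p) (RatFunc2 p))
    (h : ∀ v, M *ᵥ v = 0 → v = 0) : IsUnit M := by
  rw [← Matrix.mulVec_injective_iff_isUnit]
  intro v w hvw
  have := h (v - w) (by rw [Matrix.mulVec_sub]; exact sub_eq_zero.2 hvw)
  exact sub_eq_zero.1 this

lemma isUnit_B (p : ℕ) [Fact p.Prime] : IsUnit (matB p) := by
  have hp := (Fact.out : p.Prime).two_le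
  apply isUnit_of_ker
  intro v hv
  funext i
  by_cases hi : (i : ℕ) + 1 < p
  · have := congrFun hv ⟨i + 1, hi⟩
    rwa [matB_mulVec_pos] at this
  · have := congrFun hv ⟨0, by omega⟩
    rw [matB_mulVec_zero _ _ _ rfl] at this
    have h2 := (mul_eq_zero.1 this).resolve_left (muVar_ne p)
    rw [Pi.zero_apply, ← h2]
    congr 1
    apply Fin.ext
    have := i.2
    simp only
    omega

lemma isUnit_B1 (p : ℕ) [Fact p.Prime] : IsUnit (matB p - 1) := by
  have hp := (Fact.out : p.Prime).two_le
  apply isUnit_of_ker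
  intro v hv
  rw [Matrix.sub_mulVec, Matrix.one_mulVec, sub_eq_zero] at hv
  have key : ∀ k (hk : k < p), v ⟨k, hk⟩ = v ⟨0, by omega⟩ := by
    intro k
    induction k with
    | zero => intro _; rfl
    | succ k ih =>
      intro hk
      rw [← ih (by omega)]
      have := congrFun hv ⟨k + 1, hk⟩
      rw [matB_mulVec_pos] at this
      exact this.symm
  have h0 := congrFun hv ⟨0, by omega⟩
  rw [matB_mulVec_zero _ _ _ rfl, key (p - 1)] at h0
  have h1 : (muVar p - 1) * v ⟨0, by omega⟩ = 0 := by rw [sub_mul, h0]; ring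
  have h2 := (mul_eq_zero.1 h1).resolve_left (sub_ne_zero.2 (muVar_ne_one p))
  funext i
  exact (key i i.2).trans h2

lemma isUnit_A_sub (p : ℕ) [Fact p.Prime] (c : RatFunc2 p) (hc : lamVar p ≠ c) :
    IsUnit (matA p - c • (1 : Matrix (Fin p) (Fin p) (RatFunc2 p))) := by
  rw [Matrix.isUnit_iff_isUnit_det, Matrix.det_of_isUpperTriangular]
  · simp [matA, isUnit_iff_ne_zero, Finset.prod_const, sub_eq_zero, hc]
  · intro i j hij
    have h1 : (j : ℕ) < i := hij
    have h2 : i ≠ j := by rintro rfl; omega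
    have h3 : ¬ (j : ℕ) = i + 1 := by omega
    simp [matA, h2, h3]

lemma isUnit_BA1 (p : ℕ) [Fact p.Prime] : IsUnit (matB p * matA p - 1) := by
  have hp := (Fact.out : p.Prime).two_le
  apply isUnit_of_ker
  intro v hv
  rw [Matrix.sub_mulVec, Matrix.one_mulVec, sub_eq_zero, ← Matrix.mulVec_mulVec] at hv
  have hs : ∀ k (hk : k + 1 < p), lamVar p * v ⟨k, by omega⟩ +
      ((k + 1 : ℕ) : RatFunc2 p) * v ⟨k + 1, hk⟩ = v ⟨k + 1, hk⟩ := by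
    intro k hk
    have := congrFun hv ⟨k + 1, hk⟩
    rw [matB_mulVec_pos, matA_mulVec, dif_pos hk] at this
    exact this
  have h0 : v ⟨0, by omega⟩ = 0 := by
    have := hs 0 (by omega)
    simp only [Nat.cast_one, zero_add, one_mul, add_eq_right] at this
    exact (mul_eq_zero.1 this).resolve_left (lamVar_ne p)
  have hl : v ⟨p - 1, by omega⟩ = 0 := by
    have := congrFun hv ⟨0, by omega⟩
    rw [matB_mulVec_zero _ _ _ rfl, matA_mulVec, dif_neg (by simp only; omega), h0, add_zero] at this
    exact (mul_eq_zero.1 ((mul_eq_zero.1 this).resolve_left (muVar_ne p))).resolve_left (lamVar_ne p)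
  have key : ∀ m (hm : m < p), v ⟨p - 1 - m, by omega⟩ = 0 := by
    intro m
    induction m with
    | zero => intro _; exact hl
    | succ m ih =>
      intro hm
      have h1 := hs (p - 1 - (m + 1)) (by omega)
      have h2 : (⟨p - 1 - (m + 1) + 1, by omega⟩ : Fin p) = ⟨p - 1 - m, by omega⟩ :=
        Fin.ext (by simp only; omega)
      rw [h2, ih (by omega), mul_zero, add_zero] at h1
      exact (mul_eq_zero.1 h1).resolve_left (lamVar_ne p)
  funext i
  have := key (p - 1 - i) (by omega)
  rw [Pi.zero_apply, ← this]
  congr 1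
  apply Fin.ext
  have := i.2
  simp only
  omega

lemma comm_AB (p : ℕ) [Fact p.Prime] : matA p * matB p - matB p * matA p = 1 := by
  have hp := (Fact.out : p.Prime).two_le
  have hcast : ((p : ℕ) : RatFunc2 p) = 0 := by
    have : ((p : ℕ) : MvPolynomial (Fin 2) (ZMod p)) = 0 := CharP.cast_eq_zero _ p
    rw [← map_natCast (algebraMap (MvPolynomial (Fin 2) (ZMod p)) (RatFunc2 p)), this, map_zero]
  apply Matrix.ext_of_mulVec_single
  intro j
  generalize (Pi.single j 1 : Fin p → RatFunc2 p) = v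
  rw [Matrix.sub_mulVec, Matrix.one_mulVec, sub_eq_iff_eq_add, ← Matrix.mulVec_mulVec,
    ← Matrix.mulVec_mulVec]
  funext ⟨i, hi⟩
  rw [Pi.add_apply, matA_mulVec]
  cases i with
  | zero =>
    rw [matB_mulVec_zero _ _ _ rfl, matB_mulVec_zero _ _ _ rfl, dif_pos (by simp only; omega),
      matA_mulVec, dif_neg (by simp only; omega), matB_mulVec_pos]
    simp
    ring
  | succ k =>
    rw [matB_mulVec_pos, matB_mulVec_pos, matA_mulVec,
      dif_pos (show ((⟨k, by omega⟩ : Fin p) : ℕ) + 1 < p from hi)]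
    by_cases h : k + 1 + 1 < p
    · rw [dif_pos (by simpa using h), matB_mulVec_pos]
      push_cast
      ring
    · rw [dif_neg (by simpa using h)]
      have h2 : k + 1 + 1 = p := by omega
      have h3 : ((k : RatFunc2 p) + 1) + 1 = 0 := by
        have h5 := congrArg (Nat.cast : ℕ → RatFunc2 p) h2
        rw [hcast] at h5
        push_cast at h5
        exact h5
      have h4 : (k : RatFunc2 p) + 1 = -1 := eq_neg_of_add_eq_zero_left h3
      push_cast
      rw [h4]
      ring

lemma isUnit_A_sub_B (p : ℕ) [Fact p.Prime] : IsUnit (matA p - matB p) := by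
  let P : Matrix (Fin p) (Fin p) (MvPolynomial (Fin 2) (ZMod p)) := Matrix.of fun i j =>
    (if i = j then MvPolynomial.X 0
    else if (j : ℕ) = (i : ℕ) + 1 then (((i : ℕ) + 1 : ℕ) : (MvPolynomial (Fin 2) (ZMod p)))
    else 0) - (if (i : ℕ) = 0 ∧ (j : ℕ) = p - 1 then MvPolynomial.X 1
    else if (i : ℕ) = (j : ℕ) + 1 then 1
    else 0)
  let M : Matrix (Fin p) (Fin p) (ZMod p) := Matrix.of fun i j =>
    (if (i : ℕ) = (j : ℕ) + 1 then 1 else 0) -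
      (if (j : ℕ) = (i : ℕ) + 1 then (((i : ℕ) + 1 : ℕ) : ZMod p) else 0)
  let φ : (MvPolynomial (Fin 2) (ZMod p)) →+* Polynomial (ZMod p) :=
    MvPolynomial.eval₂Hom Polynomial.C ![Polynomial.X, 0]
  have hP : matA p - matB p = (algebraMap (MvPolynomial (Fin 2) (ZMod p)) (RatFunc2 p)).mapMatrix P := by
    ext i j
    simp only [matA, matB, P, Matrix.sub_apply, Matrix.of_apply, RingHom.mapMatrix_apply,
      Matrix.map_apply, map_sub, lamVar, muVar]
    congr 1 <;> split_ifs <;> simp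
  have hM : φ.mapMatrix P = M.charmatrix := by
    have hp := (Fact.out : p.Prime).two_le
    have e0 : φ (MvPolynomial.X 0) = Polynomial.X := by simp [φ]
    have e1 : φ (MvPolynomial.X 1) = 0 := by simp [φ]
    ext1 i j
    simp only [RingHom.mapMatrix_apply, Matrix.map_apply, P, M, Matrix.of_apply,
      Matrix.charmatrix_apply, map_sub, apply_ite φ, e0, e1, Matrix.diagonal_apply, map_natCast,
      map_zero, map_one, apply_ite Polynomial.C]
    by_cases hij : i = j
    · subst hij
      have : ¬ ((i : ℕ) = 0 ∧ (i : ℕ) = p - 1) := by omega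
      simp
    · by_cases h0 : (i : ℕ) = 0 ∧ (j : ℕ) = p - 1
      · have : ¬ (i : ℕ) = j + 1 := by omega
        simp [hij, h0]
      · simp only [hij, h0, if_false]
        ring
  have hdet : P.det ≠ 0 := by
    intro h
    have h1 : φ P.det = M.charpoly := by rw [RingHom.map_det, hM]; rfl
    rw [h, map_zero] at h1
    exact (Matrix.charpoly_monic M).ne_zero h1.symm
  rw [Matrix.isUnit_iff_isUnit_det, hP, ← RingHom.map_det, isUnit_iff_ne_zero, Ne,
    FaithfulSMul.algebraMap_eq_zero_iff]
  exact hdet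

theorem stmt_19 (p : ℕ) [Fact p.Prime] :
    IsUnit (matA p - 1) ∧ IsUnit (matB p - 1) ∧ IsUnit (matA p - matB p) ∧
    IsUnit (matA p * matB p - 1) ∧ IsUnit (matB p * matA p - 1) ∧
    IsUnit (matA p * matB p - matA p) ∧ IsUnit (matA p * matB p - matB p) ∧
    IsUnit (matB p * matA p - matA p) ∧ IsUnit (matB p * matA p - matB p) ∧
    IsUnit (matA p * matB p - matB p * matA p) := by
  have hA : IsUnit (matA p) := by simpa using isUnit_A_sub p 0 (lamVar_ne p)
  have hA1 : IsUnit (matA p - 1) := by simpa using isUnit_A_sub p 1 (lamVar_ne_one p)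
  have hB := isUnit_B p
  have hB1 := isUnit_B1 p
  have hc := comm_AB p
  refine ⟨hA1, hB1, isUnit_A_sub_B p, ?_, isUnit_BA1 p, ?_, ?_, ?_, ?_, ?_⟩
  · have : matA p * matB p - 1 = matB p * matA p := by rw [← hc]; abel
    rw [this]; exact hB.mul hA
  · have := hA.mul hB1
    rwa [mul_sub, mul_one] at this
  · have := hA1.mul hB
    rwa [sub_mul, one_mul] at this
  · have := hB1.mul hA
    rwa [sub_mul, one_mul] at this
  · have := hB.mul hA1
    rwa [mul_sub, mul_one] at this
  · rw [hc]; exact isUnit_one
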